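/- arXiv:2602.18211 — 8 statements merged into one kernel-verified Lean document; each statement's English description precedes it below -/
import Mathlib

section
/- Theorem 2.4(i) (linear growth of the resolvent norm along a segment). Let H be a complex Hilbert space and R : H →L[ℂ] H a nonzero bounded operator. Suppose (ψₙ, c₀) is norm determining for R, and that there exist θ₀ ∈ ℝ, c₁ > 0 and μ ∈ (0, π/2) such that for every n ≥ 1 one has |αₙ| ≥ c₁ and Re(e^{−iθ₀} αₙ) ≥ cos(μ)·|αₙ|. Then there exist a₀ > 0 and C₁ > 0 such that for every t ∈ [0,1], writing w = t·a₀·e^{−iθ₀}, the operator I − w R is invertible and ‖R (I − w R)⁻¹‖ ≥ ‖R‖ + C₁·|w|. -/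
/-- Theorem 2.4(i): linear growth of the resolvent norm along a segment. -/
theorem resolvent_norm_linear_growth
    {H : Type*} [NormedAddCommGroup H] [InnerProductSpace ℂ H] [CompleteSpace H]
    (R : H →L[ℂ] H) (hR : R ≠ 0)
    (ψ : ℕ → H) (c₀ : ℝ) (hc₀ : 0 < c₀)
    (hψ : ∀ n : ℕ, 1 ≤ n → ‖ψ n‖ = 1)
    (hnd : ∀ n : ℕ, 1 ≤ n → ‖R (ψ n)‖ ≥ ‖R‖ - c₀ / n ∧ 0 < ‖R‖ - c₀ / n)
    (θ₀ : ℝ) (c₁ : ℝ) (hc₁ : 0 < c₁) (μ : ℝ) (hμ : μ ∈ Set.Ioo 0 (Real.pi / 2))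
    (hα : ∀ n : ℕ, 1 ≤ n →
      c₁ ≤ ‖(inner ℂ (R (ψ n)) (R (R (ψ n))) : ℂ)‖ ∧
      Real.cos μ * ‖(inner ℂ (R (ψ n)) (R (R (ψ n))) : ℂ)‖ ≤
        (Complex.exp (-(θ₀ : ℂ) * Complex.I) *
          (inner ℂ (R (ψ n)) (R (R (ψ n))) : ℂ)).re) :
    ∃ a₀ > 0, ∃ C₁ > 0, ∀ t ∈ Set.Icc (0 : ℝ) 1,
      IsUnit (1 - (((t * a₀ : ℝ) : ℂ) * Complex.exp (-(θ₀ : ℂ) * Complex.I)) • R) ∧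
      ‖R‖ + C₁ * ‖((t * a₀ : ℝ) : ℂ) * Complex.exp (-(θ₀ : ℂ) * Complex.I)‖ ≤
        ‖R * Ring.inverse
          (1 - (((t * a₀ : ℝ) : ℂ) * Complex.exp (-(θ₀ : ℂ) * Complex.I)) • R)‖ := by
  obtain ⟨hμ0, hμ1⟩ := hμ
  have hcos : 0 < Real.cos μ := Real.cos_pos_of_mem_Ioo ⟨by linarith, hμ1⟩
  have hr : 0 < ‖R‖ := norm_pos_iff.mpr hR
  set r := ‖R‖ with hrdef
  set e : ℂ := Complex.exp (-(θ₀ : ℂ) * Complex.I) with he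
  have hen : ‖e‖ = 1 := by
    have := Complex.norm_exp_ofReal_mul_I (-θ₀)
    rw [he]; simpa using this
  obtain ⟨κ, hκ⟩ : ∃ κ, κ = Real.cos μ * c₁ / r := ⟨_, rfl⟩
  have hκ0 : 0 < κ := by rw [hκ]; positivity
  have hκr : κ * r = Real.cos μ * c₁ := by rw [hκ]; field_simp
  refine ⟨min (1 / (2 * r)) (κ / (4 * r ^ 3)), by positivity, κ / 2, by positivity, ?_⟩
  rintro t ⟨ht0, ht1⟩
  have ha0 : 0 < min (1 / (2 * r)) (κ / (4 * r ^ 3)) := by positivity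
  obtain ⟨s, hs⟩ : ∃ s, s = t * min (1 / (2 * r)) (κ / (4 * r ^ 3)) := ⟨_, rfl⟩
  rw [← hs]
  have hs0 : 0 ≤ s := by rw [hs]; positivity
  have hsle : s ≤ min (1 / (2 * r)) (κ / (4 * r ^ 3)) := by
    rw [hs]; exact mul_le_of_le_one_left ha0.le ht1
  have hs1 : s * r ≤ 1 / 2 := by
    have h := hsle.trans (min_le_left _ _)
    rw [le_div_iff₀ (by positivity)] at h
    linarith
  have hs2 : 4 * s * r ^ 3 ≤ κ := by
    have h := hsle.trans (min_le_right _ _)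
    rw [le_div_iff₀ (by positivity)] at h
    linarith
  set w : ℂ := (s : ℂ) * e with hw
  have hwn : ‖w‖ = s := by
    rw [hw, norm_mul, hen, mul_one, Complex.norm_real, Real.norm_of_nonneg hs0]
  have hU : IsUnit (1 - w • R) := by
    apply isUnit_one_sub_of_norm_lt_one
    rw [norm_smul, hwn]
    linarith
  refine ⟨hU, ?_⟩
  rw [hwn]
  set A := R * Ring.inverse (1 - w • R) with hA
  have hAR : A * (1 - w • R) = R := by
    rw [hA, mul_assoc, Ring.inverse_mul_cancel _ hU, mul_one]
  have hA1 : A = R + w • (A * R) := by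
    rw [mul_sub, mul_one, mul_smul_comm] at hAR
    exact sub_eq_iff_eq_add.mp hAR
  have hAn : ‖A‖ ≤ 2 * r := by
    have h1 : ‖A‖ ≤ r + s * (‖A‖ * r) := by
      calc ‖A‖ = ‖R + w • (A * R)‖ := by rw [← hA1]
        _ ≤ ‖R‖ + ‖w • (A * R)‖ := norm_add_le _ _
        _ ≤ r + s * (‖A‖ * r) := by
          rw [norm_smul, hwn]
          gcongr
          exact norm_mul_le _ _
    nlinarith [norm_nonneg A]
  have hAx : ∀ x, A x = R x + w • A (R x) := fun x => by
    have := congrArg (fun T : H →L[ℂ] H => T x) hA1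
    simpa using this
  have key : ∀ n : ℕ, 1 ≤ n → r + κ / 2 * s - ‖A‖ ≤ c₀ / n := by
    intro n hn
    obtain ⟨h1, h2⟩ := hnd n hn
    obtain ⟨h3, h4⟩ := hα n hn
    have hx := hψ n hn
    set x := ψ n
    have hp : 0 < ‖R x‖ := by linarith
    have hpr : ‖R x‖ ≤ r := by simpa [hx] using R.le_opNorm x
    have hAxn : ‖A x‖ ≤ ‖A‖ := by simpa [hx] using A.le_opNorm x
    have hexp : A x = R x + w • R (R x) + (w * w) • A (R (R x)) := by
      rw [hAx x, hAx (R x), smul_add, smul_smul, add_assoc]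
    have hrem : ‖(w * w) • A (R (R x))‖ ≤ s * s * (2 * r * (r * r)) := by
      rw [norm_smul, norm_mul, hwn]
      gcongr
      refine (A.le_opNorm _).trans ?_
      gcongr
      refine (R.le_opNorm _).trans ?_
      gcongr
    have hin : (inner ℂ (R x) (A x)).re = ‖R x‖ ^ 2 + s * (e * inner ℂ (R x) (R (R x))).re
        + (inner ℂ (R x) ((w * w) • A (R (R x)))).re := by
      conv_lhs => rw [hexp, inner_add_right, inner_add_right, inner_smul_right (𝕜 := ℂ) _ _ w,
        inner_self_eq_norm_sq_to_K]
      rw [Complex.add_re, Complex.add_re, hw, mul_assoc, Complex.re_ofReal_mul]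
      congr 2
      norm_cast
    have hle : (inner ℂ (R x) (A x)).re ≤ ‖R x‖ * ‖A x‖ :=
      (Complex.re_le_norm _).trans (norm_inner_le_norm _ _)
    have hge : -(‖R x‖ * ‖(w * w) • A (R (R x))‖) ≤ (inner ℂ (R x) ((w * w) • A (R (R x)))).re := by
      have h5 := Complex.abs_re_le_norm (inner ℂ (R x) ((w * w) • A (R (R x))))
      have h6 := norm_inner_le_norm (𝕜 := ℂ) (R x) ((w * w) • A (R (R x)))
      linarith [neg_abs_le (inner ℂ (R x) ((w * w) • A (R (R x)))).re]
    have hmain : κ * ‖R x‖ ≤ (e * inner ℂ (R x) (R (R x))).re := by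
      have h5 : κ * ‖R x‖ ≤ κ * r := by gcongr
      have h6 : Real.cos μ * c₁ ≤ Real.cos μ * ‖(inner ℂ (R x) (R (R x)) : ℂ)‖ := by gcongr
      linarith
    have h7 := mul_le_mul_of_nonneg_left hmain hs0
    have h8 := mul_le_mul_of_nonneg_left hrem hp.le
    have h9 := mul_le_mul_of_nonneg_left hAxn hp.le
    have h10 : ‖R x‖ * (‖R x‖ + s * κ - s * s * (2 * r * (r * r))) ≤ ‖R x‖ * ‖A‖ := by
      linarith
    have h11 := le_of_mul_le_mul_left h10 hp
    have h12 := mul_le_mul_of_nonneg_left hs2 hs0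
    linarith
  have hlim : Filter.Tendsto (fun n : ℕ => c₀ / (n : ℝ)) Filter.atTop (nhds 0) :=
    tendsto_const_div_atTop_nhds_zero_nat c₀
  have := ge_of_tendsto hlim (Filter.eventually_atTop.mpr ⟨1, key⟩)
  linarith
end

section
/- Theorem 2.4(ii) (quadratic growth of the resolvent norm along a segment). Let H be a complex Hilbert space and R : H →L[ℂ] H a nonzero bounded operator. Suppose (ψₙ, c₀) is norm determining for R, that αₙ = 0 for all n ≥ 1, and that there exist θ₀ ∈ ℝ, c₂ > 0 and μ ∈ (0, π/2) such that for every n ≥ 1 one has |γₙ| ≥ c₂ and Re(e^{−2iθ₀} γₙ) ≥ cos(μ)·|γₙ|. Then there exist a₀ > 0 and C₂ > 0 such that for every t ∈ [0,1], writing w = t·a₀·e^{−iθ₀}, the operator I − w R is invertible and ‖R (I − w R)⁻¹‖ ≥ ‖R‖ + C₂·|w|². -/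
theorem aux_segment
    {H : Type*} [NormedAddCommGroup H] [InnerProductSpace ℂ H]
    (R T : H →L[ℂ] H) (w : ℂ) (k : ℝ) (x : H) (hx : ‖x‖ = 1)
    (hT : T = R + w • (R * T))
    (hα : (inner ℂ (R x) (R (R x)) : ℂ) = 0)
    (hγ : ‖w‖ ^ 2 * k ≤ (w ^ 2 * (inner ℂ (R x) (R (R (R x))) : ℂ)).re) :
    ‖R x‖ ^ 2 + ‖w‖ ^ 2 * k ≤ ‖T‖ * (‖R‖ + ‖w‖ ^ 3 * ‖R‖ ^ 4) := by
  have h1 : T x = R x + w • R (T x) := by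
    conv_lhs => rw [hT]
    simp
  have h2 : T x = R x + w • R (R x) + w ^ 2 • R (R (R x)) + w ^ 3 • R (R (R (T x))) := by
    conv_lhs => rw [h1, h1, h1]
    simp only [map_add, map_smul, smul_add, smul_smul]
    rw [show w ^ 2 = w * w by ring, show w ^ 3 = w * (w * w) by ring]
    abel
  have hRx : ‖R x‖ ≤ ‖R‖ := by simpa [hx] using R.le_opNorm x
  have hTx : ‖T x‖ ≤ ‖T‖ := by simpa [hx] using T.le_opNorm x
  have h3 : (inner ℂ (R x) (T x) : ℂ) = (‖R x‖ : ℂ) ^ 2 +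
      w ^ 2 * inner ℂ (R x) (R (R (R x))) + w ^ 3 * inner ℂ (R x) (R (R (R (T x)))) := by
    conv_lhs => rw [h2]
    simp only [inner_add_right, inner_smul_right, hα, inner_self_eq_norm_sq_to_K]
    simp
  have h4 := congrArg Complex.re h3
  rw [Complex.add_re, Complex.add_re, ← Complex.ofReal_pow, Complex.ofReal_re] at h4
  have h5 : (inner ℂ (R x) (T x) : ℂ).re ≤ ‖R‖ * ‖T‖ :=
    (Complex.re_le_norm _).trans ((norm_inner_le_norm _ _).trans (by gcongr))
  have h7 : ‖R (R (R (T x)))‖ ≤ ‖R‖ * (‖R‖ * (‖R‖ * ‖T‖)) :=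
    R.le_opNorm_of_le (R.le_opNorm_of_le (R.le_opNorm_of_le hTx))
  have h6 : ‖w ^ 3 * (inner ℂ (R x) (R (R (R (T x)))) : ℂ)‖
      ≤ ‖w‖ ^ 3 * (‖R‖ * (‖R‖ * (‖R‖ * (‖R‖ * ‖T‖)))) := by
    rw [norm_mul, norm_pow]
    gcongr
    exact (norm_inner_le_norm _ _).trans (by gcongr)
  have h8 := (abs_le.mp (Complex.abs_re_le_norm
    (w ^ 3 * (inner ℂ (R x) (R (R (R (T x)))) : ℂ)))).1
  nlinarith

/-- Theorem 2.4(ii): quadratic growth of the resolvent norm along a segment. -/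
theorem resolvent_norm_quadratic_growth_segment
    {H : Type*} [NormedAddCommGroup H] [InnerProductSpace ℂ H] [CompleteSpace H]
    (R : H →L[ℂ] H) (hR : R ≠ 0)
    (ψ : ℕ → H) (c₀ : ℝ) (hc₀ : 0 < c₀)
    (hψ : ∀ n : ℕ, 1 ≤ n → ‖ψ n‖ = 1)
    (hnd : ∀ n : ℕ, 1 ≤ n → ‖R (ψ n)‖ ≥ ‖R‖ - c₀ / n ∧ 0 < ‖R‖ - c₀ / n)
    (hα : ∀ n : ℕ, 1 ≤ n → (inner ℂ (R (ψ n)) (R (R (ψ n))) : ℂ) = 0)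
    (θ₀ : ℝ) (c₂ : ℝ) (hc₂ : 0 < c₂) (μ : ℝ) (hμ : μ ∈ Set.Ioo 0 (Real.pi / 2))
    (hγ : ∀ n : ℕ, 1 ≤ n →
      c₂ ≤ ‖(inner ℂ (R (ψ n)) (R (R (R (ψ n)))) : ℂ)‖ ∧
      Real.cos μ * ‖(inner ℂ (R (ψ n)) (R (R (R (ψ n)))) : ℂ)‖ ≤
        (Complex.exp (-2 * (θ₀ : ℂ) * Complex.I) *
          (inner ℂ (R (ψ n)) (R (R (R (ψ n)))) : ℂ)).re) :
    ∃ a₀ > 0, ∃ C₂ > 0, ∀ t ∈ Set.Icc (0 : ℝ) 1,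
      IsUnit (1 - (((t * a₀ : ℝ) : ℂ) * Complex.exp (-(θ₀ : ℂ) * Complex.I)) • R) ∧
      ‖R‖ + C₂ * ‖((t * a₀ : ℝ) : ℂ) * Complex.exp (-(θ₀ : ℂ) * Complex.I)‖ ^ 2 ≤
        ‖R * Ring.inverse
          (1 - (((t * a₀ : ℝ) : ℂ) * Complex.exp (-(θ₀ : ℂ) * Complex.I)) • R)‖ := by
  have hr : 0 < ‖R‖ := norm_pos_iff.mpr hR
  have hcos : 0 < Real.cos μ := Real.cos_pos_of_mem_Ioo ⟨by linarith [hμ.1, Real.pi_pos], hμ.2⟩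
  obtain ⟨k, hk⟩ : ∃ k, k = Real.cos μ * c₂ := ⟨_, rfl⟩
  have hk0 : 0 < k := by rw [hk]; positivity
  refine ⟨min (1 / (2 * ‖R‖)) (k / (4 * ‖R‖ ^ 5)), by positivity, k / (4 * ‖R‖), by positivity, ?_⟩
  intro t ht
  obtain ⟨a, ha⟩ : ∃ a, a = min (1 / (2 * ‖R‖)) (k / (4 * ‖R‖ ^ 5)) := ⟨_, rfl⟩
  rw [← ha]
  have ha0 : 0 < a := by rw [ha]; positivity
  have ha1 : a * (2 * ‖R‖) ≤ 1 := by
    rw [← le_div_iff₀ (by positivity), ha]; exact min_le_left _ _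
  have ha2 : a * (4 * ‖R‖ ^ 5) ≤ k := by
    rw [← le_div_iff₀ (by positivity), ha]; exact min_le_right _ _
  obtain ⟨s, hs⟩ : ∃ s, s = t * a := ⟨_, rfl⟩
  have hs0 : 0 ≤ s := by rw [hs]; exact mul_nonneg ht.1 ha0.le
  have hsa : s ≤ a := by rw [hs]; exact mul_le_of_le_one_left ha0.le ht.2
  rw [← hs]
  obtain ⟨w, hw⟩ : ∃ w, w = (s : ℂ) * Complex.exp (-(θ₀ : ℂ) * Complex.I) := ⟨_, rfl⟩
  rw [← hw]
  have hwn : ‖w‖ = s := by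
    rw [hw, norm_mul, ← Complex.ofReal_neg, Complex.norm_exp_ofReal_mul_I, Complex.norm_real,
      Real.norm_of_nonneg hs0, mul_one]
  have hw2 : w ^ 2 = (s ^ 2 : ℝ) * Complex.exp (-2 * (θ₀ : ℂ) * Complex.I) := by
    rw [hw, mul_pow, ← Complex.exp_nat_mul]
    push_cast
    congr 2
    ring
  have hs1 : s * (2 * ‖R‖) ≤ 1 := le_trans (by gcongr) ha1
  have hs2 : s * (4 * ‖R‖ ^ 5) ≤ k := le_trans (by gcongr) ha2
  have hU : IsUnit (1 - w • R) := by
    apply isUnit_one_sub_of_norm_lt_one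
    rw [norm_smul, hwn]
    linarith
  refine ⟨hU, ?_⟩
  obtain ⟨T, hTd⟩ : ∃ T, T = R * Ring.inverse (1 - w • R) := ⟨_, rfl⟩
  rw [← hTd, hwn]
  have hT : T = R + w • (R * T) := by
    have h1 := Ring.mul_inverse_cancel _ hU
    have h2 : Ring.inverse (1 - w • R) = 1 + w • T := by
      rw [sub_mul, one_mul, smul_mul_assoc, ← hTd] at h1
      exact sub_eq_iff_eq_add.mp h1
    conv_lhs => rw [hTd, h2]
    rw [mul_add, mul_one, mul_smul_comm]
  have key : ∀ n : ℕ, 1 ≤ n →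
      (‖R‖ - c₀ / n) ^ 2 + s ^ 2 * k ≤ ‖T‖ * (‖R‖ + s ^ 3 * ‖R‖ ^ 4) := by
    intro n hn
    have h := aux_segment R T w k (ψ n) (hψ n hn) hT (hα n hn) (by
      rw [hw2, hwn, mul_assoc, Complex.re_ofReal_mul]
      refine mul_le_mul_of_nonneg_left ?_ (by positivity)
      refine le_trans ?_ (hγ n hn).2
      rw [hk]
      exact mul_le_mul_of_nonneg_left (hγ n hn).1 hcos.le)
    rw [hwn] at h
    have := pow_le_pow_left₀ (hnd n hn).2.le (hnd n hn).1 2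
    linarith
  have lim : Filter.Tendsto (fun n : ℕ => (‖R‖ - c₀ / n) ^ 2 + s ^ 2 * k) Filter.atTop
      (nhds ((‖R‖ - 0) ^ 2 + s ^ 2 * k)) :=
    (((tendsto_const_div_atTop_nhds_zero_nat c₀).const_sub ‖R‖).pow 2).add_const _
  have fin := le_of_tendsto lim (Filter.eventually_atTop.mpr ⟨1, key⟩)
  rw [sub_zero] at fin
  have hpos : 0 < ‖R‖ + s ^ 3 * ‖R‖ ^ 4 := by positivity
  refine le_of_mul_le_mul_right (le_trans ?_ fin) hpos
  obtain ⟨C, hC⟩ : ∃ C, C = k / (4 * ‖R‖) := ⟨_, rfl⟩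
  rw [← hC]
  have hC0 : 0 < C := by rw [hC]; positivity
  have hCr : C * ‖R‖ = k / 4 := by rw [hC]; field_simp
  have hsr : (s * ‖R‖) ^ 3 ≤ 1 := pow_le_one₀ (by positivity) (by linarith)
  have e1 : (‖R‖ + C * s ^ 2) * (‖R‖ + s ^ 3 * ‖R‖ ^ 4) =
      ‖R‖ ^ 2 + s ^ 2 * (C * ‖R‖ + s * ‖R‖ ^ 5 + C * ‖R‖ * (s * ‖R‖) ^ 3) := by ring
  rw [e1, hCr]
  gcongr
  nlinarith
end

section
/- Theorem 2.4(iii) (quadratic growth of the resolvent norm in every direction, i.e. a local minimum). Let H be a complex Hilbert space and R : H →L[ℂ] H a nonzero bounded operator. Suppose (ψₙ, c₀) is norm determining for R, that αₙ = 0 and γₙ = 0 for all n ≥ 1, and that there exists c₃ > 0 with βₙ ≥ c₃ for all n ≥ 1. Then there exist ε₀ > 0 and C₃ > 0 such that for every w ∈ ℂ with |w| ≤ ε₀, the operator I − w R is invertible and ‖R (I − w R)⁻¹‖ ≥ ‖R‖ + C₃·|w|². -/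
lemma key_bound {H : Type*} [NormedAddCommGroup H] [InnerProductSpace ℂ H]
    (R : H →L[ℂ] H) (p f : H) (w : ℂ) (t c : ℝ) (hp : ‖p‖ = 1)
    (hf : f = p + w • R f) (ht : ‖R f‖ ≤ t)
    (h1 : (inner ℂ (R p) (R (R p)) : ℂ) = 0)
    (h2 : (inner ℂ (R p) (R (R (R p))) : ℂ) = 0)
    (hc : c ≤ ‖R (R p)‖ ^ 2) :
    ‖R p‖ ^ 2 + ‖w‖ ^ 2 * c - 4 * ‖w‖ ^ 3 * (‖R‖ ^ 4 * t) ≤ ‖R f‖ ^ 2 := by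
  have e1 : R f = R p + w • R (R f) := by
    conv_lhs => rw [hf]
    simp
  have e2 : R (R f) = R (R p) + w • R (R (R f)) := by
    conv_lhs => rw [e1]
    simp
  have e3 : R (R (R f)) = R (R (R p)) + w • R (R (R (R f))) := by
    conv_lhs => rw [e2]
    simp
  have b1 : ‖R p‖ ≤ ‖R‖ := by simpa [hp] using R.le_opNorm p
  have b2 : ‖R (R p)‖ ≤ ‖R‖ ^ 2 := by
    calc _ ≤ ‖R‖ * ‖R p‖ := R.le_opNorm _
      _ ≤ ‖R‖ * ‖R‖ := by gcongr
      _ = _ := by ring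
  have b3 : ‖R (R (R f))‖ ≤ ‖R‖ ^ 2 * t := by
    calc _ ≤ ‖R‖ * ‖R (R f)‖ := R.le_opNorm _
      _ ≤ ‖R‖ * (‖R‖ * ‖R f‖) := by gcongr; exact R.le_opNorm _
      _ ≤ ‖R‖ * (‖R‖ * t) := by gcongr
      _ = _ := by ring
  have b4 : ‖R (R (R (R f)))‖ ≤ ‖R‖ ^ 3 * t := by
    calc _ ≤ ‖R‖ * ‖R (R (R f))‖ := R.le_opNorm _
      _ ≤ ‖R‖ * (‖R‖ ^ 2 * t) := by gcongr
      _ = _ := by ring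
  have ht0 : 0 ≤ t := (norm_nonneg _).trans ht
  set x : H := w • w • R (R (R f)) with hx
  have e : R f = (R p + w • R (R p)) + x := by
    rw [hx]; conv_lhs => rw [e1, e2]
    rw [smul_add, add_assoc]
  have n1 : ‖R p + w • R (R p)‖ ^ 2 = ‖R p‖ ^ 2 + ‖w‖ ^ 2 * ‖R (R p)‖ ^ 2 := by
    rw [@norm_add_sq ℂ, inner_smul_right, h1, norm_smul]
    simp; ring
  have i1 : ‖(inner ℂ (R p) x : ℂ)‖ ≤ ‖w‖ ^ 3 * (‖R‖ ^ 4 * t) := by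
    rw [hx, inner_smul_right, inner_smul_right, e3, inner_add_right, h2, inner_smul_right,
      zero_add, norm_mul, norm_mul, norm_mul]
    calc _ ≤ ‖w‖ * (‖w‖ * (‖w‖ * (‖R‖ * (‖R‖ ^ 3 * t)))) := by
          gcongr
          exact (norm_inner_le_norm _ _).trans (by gcongr)
      _ = _ := by ring
  have i2 : ‖(inner ℂ (w • R (R p)) x : ℂ)‖ ≤ ‖w‖ ^ 3 * (‖R‖ ^ 4 * t) := by
    refine (norm_inner_le_norm _ _).trans ?_
    rw [hx, norm_smul, norm_smul, norm_smul]
    calc _ ≤ (‖w‖ * ‖R‖ ^ 2) * (‖w‖ * (‖w‖ * (‖R‖ ^ 2 * t))) := by gcongr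
      _ = _ := by ring
  have j1 := (abs_le.1 (Complex.abs_re_le_norm (inner ℂ (R p) x : ℂ))).1
  have j2 := (abs_le.1 (Complex.abs_re_le_norm (inner ℂ (w • R (R p)) x : ℂ))).1
  have n2 : ‖R f‖ ^ 2 = ‖R p + w • R (R p)‖ ^ 2 +
      2 * ((inner ℂ (R p) x : ℂ).re + (inner ℂ (w • R (R p)) x : ℂ).re) + ‖x‖ ^ 2 := by
    rw [e, @norm_add_sq ℂ, inner_add_left]
    simp only [RCLike.re_to_complex, Complex.add_re]
  have k := mul_le_mul_of_nonneg_left hc (sq_nonneg ‖w‖)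
  rw [n2, n1]
  nlinarith [sq_nonneg ‖x‖]

/-- Theorem 2.4(iii): quadratic growth of the resolvent norm in every direction,
i.e. a local minimum of the resolvent norm. -/
theorem resolvent_norm_local_minimum
    {H : Type*} [NormedAddCommGroup H] [InnerProductSpace ℂ H] [CompleteSpace H]
    (R : H →L[ℂ] H) (hR : R ≠ 0)
    (ψ : ℕ → H) (c₀ : ℝ) (hc₀ : 0 < c₀)
    (hψ : ∀ n : ℕ, 1 ≤ n → ‖ψ n‖ = 1)
    (hnd : ∀ n : ℕ, 1 ≤ n → ‖R (ψ n)‖ ≥ ‖R‖ - c₀ / n ∧ 0 < ‖R‖ - c₀ / n)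
    (hα : ∀ n : ℕ, 1 ≤ n → (inner ℂ (R (ψ n)) (R (R (ψ n))) : ℂ) = 0)
    (hγ : ∀ n : ℕ, 1 ≤ n → (inner ℂ (R (ψ n)) (R (R (R (ψ n)))) : ℂ) = 0)
    (c₃ : ℝ) (hc₃ : 0 < c₃)
    (hβ : ∀ n : ℕ, 1 ≤ n → c₃ ≤ ‖R (R (ψ n))‖ ^ 2) :
    ∃ ε₀ > 0, ∃ C₃ > 0, ∀ w : ℂ, ‖w‖ ≤ ε₀ →
      IsUnit (1 - w • R) ∧
      ‖R‖ + C₃ * ‖w‖ ^ 2 ≤ ‖R * Ring.inverse (1 - w • R)‖ := by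
  have hr : 0 < ‖R‖ := norm_pos_iff.2 hR
  refine ⟨min (1 / (2 * ‖R‖)) (c₃ / (16 * ‖R‖ ^ 5)), by positivity, c₃ / (6 * ‖R‖),
    by positivity, fun w hw => ?_⟩
  have hw1 : ‖w‖ * ‖R‖ ≤ 1 / 2 := by
    have := hw.trans (min_le_left _ _)
    rw [le_div_iff₀ (by positivity)] at this
    linarith
  have hw2 : ‖w‖ * (16 * ‖R‖ ^ 5) ≤ c₃ := by
    have := hw.trans (min_le_right _ _)
    rwa [le_div_iff₀ (by positivity)] at this
  have hu : IsUnit (1 - w • R) := by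
    apply isUnit_one_sub_of_norm_lt_one
    rw [norm_smul]; linarith
  refine ⟨hu, ?_⟩
  set S := Ring.inverse (1 - w • R) with hS
  have hS1 : S = 1 + w • (R * S) := by
    have := Ring.mul_inverse_cancel _ hu
    rw [← hS, sub_mul, one_mul, smul_mul_assoc] at this
    exact sub_eq_iff_eq_add.1 this
  set t := ‖R * S‖ with htd
  have ht0 : 0 ≤ t := norm_nonneg _
  have ht : t ≤ 2 * ‖R‖ := by
    have h : R * S = R + w • (R * (R * S)) := by
      conv_lhs => rw [hS1]
      rw [mul_add, mul_one, mul_smul_comm]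
    have h' : t ≤ ‖R‖ + ‖w‖ * (‖R‖ * t) := by
      calc t = ‖R + w • (R * (R * S))‖ := by rw [← h]
        _ ≤ ‖R‖ + ‖w • (R * (R * S))‖ := norm_add_le _ _
        _ ≤ _ := by rw [norm_smul]; gcongr; exact norm_mul_le _ _
    nlinarith
  have main : ∀ n : ℕ, 1 ≤ n → (‖R‖ - c₀ / n) ^ 2 ≤ t ^ 2 - ‖w‖ ^ 2 * (c₃ / 2) := by
    intro n hn
    have hb : ‖R (S (ψ n))‖ ≤ t := by
      simpa [hψ n hn] using (R * S).le_opNorm (ψ n)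
    have hf : S (ψ n) = ψ n + w • R (S (ψ n)) := by
      conv_lhs => rw [hS1]
      simp
    have k := key_bound R (ψ n) (S (ψ n)) w (2 * ‖R‖) c₃ (hψ n hn) hf (hb.trans ht)
      (hα n hn) (hγ n hn) (hβ n hn)
    have k1 : (‖R‖ - c₀ / n) ^ 2 ≤ ‖R (ψ n)‖ ^ 2 :=
      pow_le_pow_left₀ (hnd n hn).2.le (hnd n hn).1 2
    have k2 : ‖R (S (ψ n))‖ ^ 2 ≤ t ^ 2 := pow_le_pow_left₀ (norm_nonneg _) hb 2
    have k3 := mul_le_mul_of_nonneg_left hw2 (sq_nonneg ‖w‖)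
    nlinarith
  have lim : ‖R‖ ^ 2 ≤ t ^ 2 - ‖w‖ ^ 2 * (c₃ / 2) := by
    have l : Filter.Tendsto (fun n : ℕ => (‖R‖ - c₀ / n) ^ 2) Filter.atTop
        (nhds ((‖R‖ - 0) ^ 2)) :=
      (tendsto_const_nhds.sub (tendsto_const_div_atTop_nhds_zero_nat c₀)).pow 2
    rw [sub_zero] at l
    exact le_of_tendsto l (Filter.eventually_atTop.2 ⟨1, main⟩)
  have hge : ‖R‖ ≤ t := by
    refine (sq_le_sq₀ hr.le ht0).1 ?_
    nlinarith [mul_nonneg (sq_nonneg ‖w‖) hc₃.le]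
  have : c₃ / (6 * ‖R‖) * ‖w‖ ^ 2 ≤ t - ‖R‖ := by
    rw [div_mul_eq_mul_div, div_le_iff₀ (by positivity)]
    nlinarith [mul_nonneg (sub_nonneg.2 hge) (sub_nonneg.2 ht)]
  linarith
end

section
/- Corollary 2.6(i). Let H be a complex Hilbert space and R : H →L[ℂ] H a nonzero bounded operator. Suppose there is a unit vector ψ ∈ H with ‖R ψ‖ = ‖R‖, and suppose ⟨R ψ, R² ψ⟩ ≠ 0. Then there exist θ₀ ∈ ℝ, a₀ > 0 and C₁ > 0 such that for every t ∈ [0,1], writing w = t·a₀·e^{−iθ₀}, the operator I − w R is invertible and ‖R (I − w R)⁻¹‖ ≥ ‖R‖ + C₁·|w|. -/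
/-- Corollary 2.6(i): linear growth when the norm is attained and α ≠ 0. -/
theorem resolvent_norm_linear_growth_attained
    {H : Type*} [NormedAddCommGroup H] [InnerProductSpace ℂ H] [CompleteSpace H]
    (R : H →L[ℂ] H) (hR : R ≠ 0)
    (ψ : H) (hψ : ‖ψ‖ = 1) (hRψ : ‖R ψ‖ = ‖R‖)
    (hα : (inner ℂ (R ψ) (R (R ψ)) : ℂ) ≠ 0) :
    ∃ θ₀ : ℝ, ∃ a₀ > 0, ∃ C₁ > 0, ∀ t ∈ Set.Icc (0 : ℝ) 1,
      IsUnit (1 - (((t * a₀ : ℝ) : ℂ) * Complex.exp (-(θ₀ : ℂ) * Complex.I)) • R) ∧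
      ‖R‖ + C₁ * ‖((t * a₀ : ℝ) : ℂ) * Complex.exp (-(θ₀ : ℂ) * Complex.I)‖ ≤
        ‖R * Ring.inverse
          (1 - (((t * a₀ : ℝ) : ℂ) * Complex.exp (-(θ₀ : ℂ) * Complex.I)) • R)‖ := by
  have hr : 0 < ‖R‖ := norm_pos_iff.mpr hR
  set α : ℂ := inner ℂ (R ψ) (R (R ψ)) with hαdef
  have hm : 0 < ‖α‖ := norm_pos_iff.mpr hα
  have hle : ‖α‖ ≤ ‖R‖ ^ 3 := by
    have h1 := norm_inner_le_norm (𝕜 := ℂ) (R ψ) (R (R ψ))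
    have h2 := R.le_opNorm (R ψ)
    rw [hRψ] at h1 h2
    have h3 := mul_le_mul_of_nonneg_left h2 hr.le
    calc ‖α‖ ≤ _ := h1
      _ ≤ _ := h3
      _ = _ := by ring
  refine ⟨α.arg, ‖α‖ / (4 * ‖R‖ ^ 4), by positivity, ‖α‖ / (2 * ‖R‖), by positivity, ?_⟩
  rintro t ⟨ht0, ht1⟩
  set s : ℝ := t * (‖α‖ / (4 * ‖R‖ ^ 4)) with hs
  have hs0 : 0 ≤ s := by positivity
  have hs1 : s * (4 * ‖R‖ ^ 4) ≤ ‖α‖ := by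
    have : s * (4 * ‖R‖ ^ 4) = t * ‖α‖ := by rw [hs]; field_simp
    rw [this]; nlinarith
  have hs2 : s * ‖R‖ ≤ 1 / 4 := by
    have h3 : 0 < ‖R‖ ^ 3 := by positivity
    have : (s * ‖R‖ * 4) * ‖R‖ ^ 3 ≤ 1 * ‖R‖ ^ 3 := by nlinarith
    have := le_of_mul_le_mul_right this h3
    linarith
  set w : ℂ := (s : ℂ) * Complex.exp (-(α.arg : ℂ) * Complex.I) with hw
  have hwn : ‖w‖ = s := by
    rw [hw, norm_mul, Complex.norm_real, ← Complex.ofReal_neg, Complex.norm_exp_ofReal_mul_I,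
      mul_one, Real.norm_of_nonneg hs0]
  have hwα : w * α = ((s * ‖α‖ : ℝ) : ℂ) := by
    have h1 := Complex.norm_mul_exp_arg_mul_I α
    have h2 : Complex.exp (-(α.arg : ℂ) * Complex.I) * Complex.exp ((α.arg : ℂ) * Complex.I) = 1 := by
      rw [← Complex.exp_add]; simp
    calc w * α = w * (‖α‖ * Complex.exp (α.arg * Complex.I)) := by rw [h1]
      _ = s * ‖α‖ * (Complex.exp (-(α.arg : ℂ) * Complex.I) *
            Complex.exp ((α.arg : ℂ) * Complex.I)) := by rw [hw]; ring
      _ = _ := by rw [h2]; push_cast; ring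
  have hu : IsUnit (1 - w • R) := by
    apply isUnit_one_sub_of_norm_lt_one
    rw [norm_smul, hwn]; linarith
  refine ⟨hu, ?_⟩
  rw [hwn]
  set φ : H := Ring.inverse (1 - w • R) ψ with hφ
  have e0 : φ - w • R φ = ψ := by
    have := congrArg (fun T : H →L[ℂ] H => T ψ) (Ring.mul_inverse_cancel _ hu)
    simpa using this
  have e1 : φ = ψ + w • R φ := by rw [← e0]; abel_nf
  have e2 : R φ = R ψ + w • R (R φ) := by
    conv_lhs => rw [e1]
    simp
  have e3 : R (R φ) = R (R ψ) + w • R (R (R φ)) := by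
    conv_lhs => rw [e2]
    simp
  have e4 : R φ = R ψ + w • R (R ψ) + (w * w) • R (R (R φ)) := by
    conv_lhs => rw [e2, e3]
    rw [smul_add, smul_smul, add_assoc]
  have n1 : ‖φ‖ ≤ 2 := by
    have h1 : ‖φ‖ ≤ ‖ψ‖ + ‖w • R φ‖ := by
      conv_lhs => rw [e1]
      exact norm_add_le _ _
    rw [norm_smul, hwn, hψ] at h1
    have h2 := mul_le_mul_of_nonneg_left (R.le_opNorm φ) hs0
    have h3 := mul_le_mul_of_nonneg_right hs2 (norm_nonneg φ)
    nlinarith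
  have n2 : ‖R (R (R φ))‖ ≤ ‖R‖ ^ 3 * 2 := by
    calc _ ≤ ‖R‖ * (‖R‖ * (‖R‖ * 2)) :=
          R.le_opNorm_of_le (R.le_opNorm_of_le (R.le_opNorm_of_le n1))
      _ = _ := by ring
  have n3 : ‖R φ‖ ≤ ‖R * Ring.inverse (1 - w • R)‖ := by
    have := (R * Ring.inverse (1 - w • R)).le_opNorm ψ
    rwa [hψ, mul_one] at this
  refine le_trans ?_ n3
  set β : ℂ := inner ℂ (R ψ) (R (R (R φ))) with hβ
  have n4 : ‖β‖ ≤ ‖R‖ * (‖R‖ ^ 3 * 2) := by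
    refine (norm_inner_le_norm _ _).trans ?_
    rw [hRψ]
    exact mul_le_mul_of_nonneg_left n2 hr.le
  have i1 : (inner ℂ (R ψ) (R φ) : ℂ) = ((‖R‖ ^ 2 + s * ‖α‖ : ℝ) : ℂ) + w * w * β := by
    rw [e4, inner_add_right, inner_add_right, inner_smul_right, inner_smul_right, ← hαdef, hwα,
      inner_self_eq_norm_sq_to_K, hRψ]
    push_cast
    rfl
  have i2 : ‖R‖ ^ 2 + s * ‖α‖ - s * s * ‖β‖ ≤ ‖R‖ * ‖R φ‖ := by
    have h1 := norm_inner_le_norm (𝕜 := ℂ) (R ψ) (R φ)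
    rw [hRψ] at h1
    have h2 := Complex.re_le_norm (inner ℂ (R ψ) (R φ) : ℂ)
    have h3 := Complex.abs_re_le_norm (w * w * β)
    rw [norm_mul, norm_mul, hwn] at h3
    have h4 := (abs_le.mp h3).1
    have h5 := congrArg Complex.re i1
    rw [Complex.add_re, Complex.ofReal_re] at h5
    linarith
  have i3 : s * s * ‖β‖ ≤ s * (‖α‖ / 2) := by
    rw [mul_assoc]
    apply mul_le_mul_of_nonneg_left _ hs0
    have := mul_le_mul_of_nonneg_left n4 hs0
    nlinarith
  have i4 : ‖R‖ * (‖R‖ + ‖α‖ / (2 * ‖R‖) * s) = ‖R‖ ^ 2 + s * (‖α‖ / 2) := by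
    field_simp
  refine le_of_mul_le_mul_left ?_ hr
  rw [i4]
  linarith
end

section
/- Corollary 2.6(ii). Let H be a complex Hilbert space and R : H →L[ℂ] H a nonzero bounded operator. Suppose there is a unit vector ψ ∈ H with ‖R ψ‖ = ‖R‖, and suppose ⟨R ψ, R² ψ⟩ = 0 and ⟨R ψ, R³ ψ⟩ ≠ 0. Then there exist θ₀ ∈ ℝ, a₀ > 0 and C₂ > 0 such that for every t ∈ [0,1], writing w = t·a₀·e^{−iθ₀}, the operator I − w R is invertible and ‖R (I − w R)⁻¹‖ ≥ ‖R‖ + C₂·|w|². -/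
theorem aux_growth
    {H : Type*} [NormedAddCommGroup H] [InnerProductSpace ℂ H]
    (R S : H →L[ℂ] H) (w : ℂ) (ψ : H) (hψ : ‖ψ‖ = 1) (hRψ : ‖R ψ‖ = ‖R‖)
    (hα : (inner ℂ (R ψ) (R (R ψ)) : ℂ) = 0) (g : ℝ)
    (hw : w ^ 2 * (inner ℂ (R ψ) (R (R (R ψ))) : ℂ) = ((‖w‖ ^ 2 * g : ℝ) : ℂ))
    (hS : ∀ x, S x = R x + w • S (R x)) :
    ‖R‖ ^ 2 + ‖w‖ ^ 2 * g ≤ ‖R‖ * ‖S‖ + ‖w‖ ^ 3 * (‖R‖ ^ 4 * ‖S‖) := by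
  have e : S ψ = R ψ + w • R (R ψ) + w ^ 2 • R (R (R ψ)) + w ^ 3 • S (R (R (R ψ))) := by
    rw [hS ψ, hS (R ψ), hS (R (R ψ))]
    module
  have e2 : (inner ℂ (R ψ) (S ψ) : ℂ) = ((‖R‖ ^ 2 + ‖w‖ ^ 2 * g : ℝ) : ℂ)
      + w ^ 3 * inner ℂ (R ψ) (S (R (R (R ψ)))) := by
    rw [e]
    simp only [inner_add_right, inner_smul_right, hα, hw, inner_self_eq_norm_sq_to_K, hRψ]
    push_cast
    simp
  have e3 : ((‖R‖ ^ 2 + ‖w‖ ^ 2 * g : ℝ) : ℂ) = inner ℂ (R ψ) (S ψ)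
      - w ^ 3 * inner ℂ (R ψ) (S (R (R (R ψ)))) := by rw [e2]; ring
  have h1 : ‖(inner ℂ (R ψ) (S ψ) : ℂ)‖ ≤ ‖R‖ * ‖S‖ := by
    refine (norm_inner_le_norm _ _).trans ?_
    rw [hRψ]
    gcongr
    simpa [hψ] using S.le_opNorm ψ
  have h2 : ‖(inner ℂ (R ψ) (S (R (R (R ψ)))) : ℂ)‖ ≤ ‖R‖ ^ 4 * ‖S‖ := by
    refine (norm_inner_le_norm _ _).trans ?_
    rw [hRψ]
    calc ‖R‖ * ‖S (R (R (R ψ)))‖ ≤ ‖R‖ * (‖S‖ * (‖R‖ * (‖R‖ * ‖R‖))) := by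
          gcongr
          refine (S.le_opNorm _).trans ?_
          gcongr
          refine (R.le_opNorm _).trans ?_
          gcongr
          refine (R.le_opNorm _).trans ?_
          rw [hRψ]
      _ = _ := by ring
  calc ‖R‖ ^ 2 + ‖w‖ ^ 2 * g ≤ ‖((‖R‖ ^ 2 + ‖w‖ ^ 2 * g : ℝ) : ℂ)‖ := by
        rw [Complex.norm_real]; exact le_abs_self _
    _ ≤ _ := by
        rw [e3]
        refine (norm_sub_le _ _).trans ?_
        rw [norm_mul, norm_pow]
        gcongr

theorem aux_real (r s g a x : ℝ) (hr : 0 < r) (hg : 0 < g) (hgr : g ≤ r ^ 4)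
    (ha : a * (4 * r ^ 5) = g) (hx0 : 0 ≤ x) (hx : x ≤ a)
    (h : r ^ 2 + x ^ 2 * g ≤ r * s + x ^ 3 * (r ^ 4 * s)) :
    r + g / (2 * r) * x ^ 2 ≤ s := by
  have hxg : x * (4 * r ^ 5) ≤ g := by rw [← ha]; gcongr
  rcases le_or_gt s (2 * r) with hs | hs
  · have h1 : x ^ 3 * (r ^ 4 * s) ≤ x ^ 3 * (r ^ 4 * (2 * r)) := by gcongr
    have h2 : x ^ 2 * (x * (4 * r ^ 5)) ≤ x ^ 2 * g := by gcongr
    have h3 : r * (r + g / (2 * r) * x ^ 2) ≤ r * s := by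
      have : r * (r + g / (2 * r) * x ^ 2) = r ^ 2 + x ^ 2 * g / 2 := by
        field_simp
      rw [this]
      nlinarith
    exact le_of_mul_le_mul_left h3 hr
  · have h4 : x * r ≤ 1 := by
      have : (x * r) * (4 * r ^ 4) ≤ 1 * (4 * r ^ 4) := by nlinarith [pow_pos hr 4]
      exact le_of_mul_le_mul_right this (by positivity)
    have h5 : g / (2 * r) * x ^ 2 ≤ r := by
      rw [div_mul_eq_mul_div, div_le_iff₀ (by positivity)]
      have h6 : g * x ^ 2 ≤ r ^ 4 * x ^ 2 := by gcongr
      have h7 : (x * r) ^ 2 ≤ 1 := pow_le_one₀ (by positivity) h4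
      have h8 : r ^ 2 * (x * r) ^ 2 ≤ r ^ 2 * 1 := by gcongr
      nlinarith
    linarith

/-- Corollary 2.6(ii): quadratic growth along a segment when the norm is attained,
α = 0 and γ ≠ 0. -/
theorem resolvent_norm_quadratic_growth_attained
    {H : Type*} [NormedAddCommGroup H] [InnerProductSpace ℂ H] [CompleteSpace H]
    (R : H →L[ℂ] H) (hR : R ≠ 0)
    (ψ : H) (hψ : ‖ψ‖ = 1) (hRψ : ‖R ψ‖ = ‖R‖)
    (hα : (inner ℂ (R ψ) (R (R ψ)) : ℂ) = 0)
    (hγ : (inner ℂ (R ψ) (R (R (R ψ))) : ℂ) ≠ 0) :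
    ∃ θ₀ : ℝ, ∃ a₀ > 0, ∃ C₂ > 0, ∀ t ∈ Set.Icc (0 : ℝ) 1,
      IsUnit (1 - (((t * a₀ : ℝ) : ℂ) * Complex.exp (-(θ₀ : ℂ) * Complex.I)) • R) ∧
      ‖R‖ + C₂ * ‖((t * a₀ : ℝ) : ℂ) * Complex.exp (-(θ₀ : ℂ) * Complex.I)‖ ^ 2 ≤
        ‖R * Ring.inverse
          (1 - (((t * a₀ : ℝ) : ℂ) * Complex.exp (-(θ₀ : ℂ) * Complex.I)) • R)‖ := by
  set γ : ℂ := inner ℂ (R ψ) (R (R (R ψ))) with hγd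
  have hr : 0 < ‖R‖ := norm_pos_iff.mpr hR
  have hg : 0 < ‖γ‖ := norm_pos_iff.mpr hγ
  have hgr : ‖γ‖ ≤ ‖R‖ ^ 4 := by
    refine (norm_inner_le_norm _ _).trans ?_
    calc ‖R ψ‖ * ‖R (R (R ψ))‖ ≤ ‖R‖ * (‖R‖ * (‖R‖ * ‖R‖)) := by
          rw [hRψ]
          gcongr
          refine (R.le_opNorm _).trans ?_
          gcongr
          refine (R.le_opNorm _).trans ?_
          rw [hRψ]
      _ = _ := by ring
  refine ⟨γ.arg / 2, ‖γ‖ / (4 * ‖R‖ ^ 5), by positivity, ‖γ‖ / (2 * ‖R‖), by positivity, ?_⟩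
  rintro t ⟨ht0, ht1⟩
  set a : ℝ := ‖γ‖ / (4 * ‖R‖ ^ 5) with had
  have ha0 : 0 < a := by positivity
  have ha : a * (4 * ‖R‖ ^ 5) = ‖γ‖ := by rw [had]; field_simp
  set E : ℂ := Complex.exp (-((γ.arg / 2 : ℝ) : ℂ) * Complex.I) with hE
  have hEn : ‖E‖ = 1 := by
    rw [hE, ← Complex.ofReal_neg]; exact Complex.norm_exp_ofReal_mul_I _
  have hE2 : E ^ 2 * γ = (‖γ‖ : ℂ) := by
    conv_lhs => rw [← Complex.norm_mul_exp_arg_mul_I γ]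
    rw [hE, ← Complex.exp_nat_mul, mul_left_comm, ← Complex.exp_add]
    have : ((2 : ℕ) : ℂ) * (-((γ.arg / 2 : ℝ) : ℂ) * Complex.I) + γ.arg * Complex.I = 0 := by
      push_cast; ring
    rw [this]; simp
  set w : ℂ := ((t * a : ℝ) : ℂ) * E with hw
  have hwn : ‖w‖ = t * a := by
    rw [hw, norm_mul, hEn, Complex.norm_real, Real.norm_of_nonneg (by positivity), mul_one]
  have hwa : ‖w‖ ≤ a := by rw [hwn]; nlinarith
  have hlt : ‖w • R‖ < 1 := by
    rw [norm_smul]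
    have : (‖w‖ * ‖R‖) * (4 * ‖R‖ ^ 4) ≤ (1 / 4) * (4 * ‖R‖ ^ 4) := by
      have : ‖w‖ * (4 * ‖R‖ ^ 5) ≤ a * (4 * ‖R‖ ^ 5) := by gcongr
      nlinarith
    have := le_of_mul_le_mul_right this (by positivity)
    linarith
  have hu : IsUnit (1 - w • R) := isUnit_one_sub_of_norm_lt_one hlt
  refine ⟨hu, ?_⟩
  refine aux_real ‖R‖ _ ‖γ‖ a ‖w‖ hr hg hgr ha (norm_nonneg _) hwa ?_
  refine aux_growth R _ w ψ hψ hRψ hα ‖γ‖ ?_ ?_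
  · rw [hwn, ← hγd, hw, mul_pow, mul_assoc, hE2]; push_cast; ring
  · intro x
    have h1 := congrArg (fun T : H →L[ℂ] H => R (T x)) (Ring.inverse_mul_cancel _ hu)
    simp only [ContinuousLinearMap.mul_apply, ContinuousLinearMap.sub_apply,
      ContinuousLinearMap.one_apply, ContinuousLinearMap.smul_apply, map_sub, map_smul] at h1 ⊢
    exact sub_eq_iff_eq_add.mp h1
end

section
/- Example 3.5, local minimum of the resolvent norm at 0. Let a : ℤ → ℂ be a bounded sequence with a_j ≠ 0 for all j ∈ ℤ and |a₀| ≥ |a_j| for all j ∈ ℤ, and let S : ℓ²(ℤ) →L[ℂ] ℓ²(ℤ) be the bounded operator satisfying (S x)_j = a_j · x_{j−1} for all x ∈ ℓ²(ℤ) and j ∈ ℤ. Then there exist C > 0 and ε₀ > 0 such that for every ζ ∈ ℂ with |ζ| ≤ ε₀, the operator I − ζ S is invertible and ‖S (I − ζ S)⁻¹‖ ≥ ‖S‖ + C·|ζ|². -/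
theorem wsl_norm_le (a : ℤ → ℂ)
    (ha₀ : ∀ j : ℤ, ‖a j‖ ≤ ‖a 0‖)
    (S : lp (fun _ : ℤ => ℂ) 2 →L[ℂ] lp (fun _ : ℤ => ℂ) 2)
    (hS : ∀ (x : lp (fun _ : ℤ => ℂ) 2) (j : ℤ), (S x) j = a j * x (j - 1)) :
    ‖S‖ ≤ ‖a 0‖ := by
  refine S.opNorm_le_bound (norm_nonneg _) fun x => ?_
  have h2 : 0 < (2 : ENNReal).toReal := by norm_num
  have hx := lp.hasSum_norm h2 x
  have hSx := lp.hasSum_norm h2 (S x)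
  simp only [ENNReal.toReal_ofNat, Real.rpow_two] at hx hSx
  have hx' : HasSum (fun j : ℤ => ‖x (j - 1)‖ ^ 2) (‖x‖ ^ 2) :=
    (Equiv.subRight (1 : ℤ)).hasSum_iff.mpr hx
  have := hasSum_le (fun j => ?_) hSx (hx'.mul_left (‖a 0‖ ^ 2))
  · rw [← mul_pow] at this
    exact (pow_le_pow_iff_left₀ (norm_nonneg _) (by positivity) two_ne_zero).mp this
  · rw [hS, norm_mul, mul_pow]
    gcongr
    exact ha₀ j

theorem wsl_single (a : ℤ → ℂ)
    (S : lp (fun _ : ℤ => ℂ) 2 →L[ℂ] lp (fun _ : ℤ => ℂ) 2)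
    (hS : ∀ (x : lp (fun _ : ℤ => ℂ) 2) (j : ℤ), (S x) j = a j * x (j - 1))
    (i k : ℤ) (hk : i + 1 = k) (c : ℂ) :
    S (lp.single 2 i c) = lp.single 2 k (a k * c) := by
  subst hk
  ext j
  rw [hS]
  simp only [lp.single_apply, Pi.single_apply]
  by_cases h : j = i + 1
  · subst h; simp
  · have : ¬ (j - 1 = i) := by omega
    simp [h, this]

theorem wsl_norm (i k : ℤ) (h : i ≠ k) (c d : ℂ) :
    ‖(lp.single 2 i c + lp.single 2 k d : lp (fun _ : ℤ => ℂ) 2)‖ ^ 2 = ‖c‖ ^ 2 + ‖d‖ ^ 2 := by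
  have h2 : 0 < (2 : ENNReal).toReal := by norm_num
  have := lp.norm_sum_single (E := fun _ : ℤ => ℂ) h2 (fun j => if j = i then c else d) {i, k}
  simpa [Finset.sum_pair h, h.symm] using this

theorem weighted_shift_local_minimum
    (a : ℤ → ℂ) (ha : BddAbove (Set.range fun j => ‖a j‖))
    (hane : ∀ j : ℤ, a j ≠ 0)
    (ha₀ : ∀ j : ℤ, ‖a j‖ ≤ ‖a 0‖)
    (S : lp (fun _ : ℤ => ℂ) 2 →L[ℂ] lp (fun _ : ℤ => ℂ) 2)
    (hS : ∀ (x : lp (fun _ : ℤ => ℂ) 2) (j : ℤ), (S x) j = a j * x (j - 1)) :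
    ∃ C > 0, ∃ ε₀ > 0, ∀ ζ : ℂ, ‖ζ‖ ≤ ε₀ →
      IsUnit (1 - ζ • S) ∧
      ‖S‖ + C * ‖ζ‖ ^ 2 ≤ ‖S * Ring.inverse (1 - ζ • S)‖ := by
  have hM : 0 < ‖a 0‖ := norm_pos_iff.mpr (hane 0)
  have hb : 0 < ‖a 1‖ := norm_pos_iff.mpr (hane 1)
  have hn := wsl_norm_le a ha₀ S hS
  have h10 := ha₀ 1
  refine ⟨‖a 0‖ * ‖a 1‖ ^ 2 / 4, by positivity, 1 / (3 * ‖a 0‖), by positivity, fun ζ hζ => ?_⟩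
  have hζM : ‖ζ‖ * ‖a 0‖ ≤ 1 / 3 := by
    rw [le_div_iff₀ (by positivity)] at hζ
    linarith
  have hu : IsUnit (1 - ζ • S) := by
    apply isUnit_one_sub_of_norm_lt_one
    rw [norm_smul]
    have : ‖ζ‖ * ‖S‖ ≤ ‖ζ‖ * ‖a 0‖ := by gcongr
    linarith
  refine ⟨hu, ?_⟩
  set y : lp (fun _ : ℤ => ℂ) 2 := lp.single 2 (-1) 1 + lp.single 2 0 (ζ * a 0) with hy
  have hSy : S y = lp.single 2 0 (a 0) + lp.single 2 1 (a 1 * (ζ * a 0)) := by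
    rw [hy, map_add, wsl_single a S hS (-1) 0 (by norm_num), wsl_single a S hS 0 1 (by norm_num),
      mul_one]
  have hx : (1 - ζ • S) y = lp.single 2 (-1) 1 + lp.single 2 1 (-(ζ * (a 1 * (ζ * a 0)))) := by
    have e : (1 - ζ • S) y = y - ζ • S y := rfl
    rw [e, hSy, hy, smul_add, ← lp.single_smul, ← lp.single_smul, lp.single_neg]
    simp only [smul_eq_mul]
    abel
  have hR : (S * Ring.inverse (1 - ζ • S)) ((1 - ζ • S) y) = S y := by
    have : (S * Ring.inverse (1 - ζ • S)) * (1 - ζ • S) = S := by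
      rw [mul_assoc, Ring.inverse_mul_cancel _ hu, mul_one]
    exact congrArg (fun T : lp (fun _ : ℤ => ℂ) 2 →L[ℂ] lp (fun _ : ℤ => ℂ) 2 => T y) this
  have hle := (S * Ring.inverse (1 - ζ • S)).le_opNorm ((1 - ζ • S) y)
  rw [hR] at hle
  set R := ‖S * Ring.inverse (1 - ζ • S)‖ with hRdef
  have hR0 : 0 ≤ R := norm_nonneg _
  have h1 := wsl_norm 0 1 (by norm_num) (a 0) (a 1 * (ζ * a 0))
  have h2 := wsl_norm (-1) 1 (by norm_num) 1 (-(ζ * (a 1 * (ζ * a 0))))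
  rw [← hSy] at h1
  rw [← hx] at h2
  have h3 : ‖S y‖ ^ 2 ≤ R ^ 2 * ‖(1 - ζ • S) y‖ ^ 2 := by
    rw [← mul_pow]; gcongr
  rw [h1, h2] at h3
  simp only [norm_neg, norm_mul, norm_one] at h3
  generalize ‖a 0‖ = M at *
  generalize ‖a 1‖ = b at *
  have hz : 0 ≤ ‖ζ‖ := norm_nonneg ζ
  generalize ‖ζ‖ = z at *
  have key : M * (1 + (b * z) ^ 2 / 4) ≤ R := by
    have hs : (z * M) ^ 2 ≤ 1 / 8 := by
      have : 0 ≤ z * M := by positivity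
      nlinarith
    have hs' : (b * z) ^ 2 ≤ 1 / 8 := by
      refine le_trans ?_ hs
      rw [mul_comm b z]
      gcongr
    have h4 : M ^ 2 * (1 + (b * z) ^ 2) ≤ R ^ 2 * (1 + (b * z) ^ 2 * (z * M) ^ 2) := by
      linarith
    have h5 : M ^ 2 * (1 + (b * z) ^ 2) ≤ R ^ 2 * (1 + (b * z) ^ 2 / 8) := by
      refine h4.trans ?_
      have := mul_le_mul_of_nonneg_left hs (sq_nonneg (b * z))
      gcongr
      linarith
    have hs0 : 0 ≤ (b * z) ^ 2 := by positivity
    generalize (b * z) ^ 2 = s at *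
    have h6 : (1 + s / 4) ^ 2 * (1 + s / 8) ≤ 1 + s := by nlinarith [mul_nonneg hs0 hs0, mul_nonneg (mul_nonneg hs0 hs0) (sub_nonneg.mpr hs'), mul_nonneg hs0 (sub_nonneg.mpr hs')]
    have h7 : (M * (1 + s / 4)) ^ 2 * (1 + s / 8) ≤ R ^ 2 * (1 + s / 8) := by
      refine le_trans ?_ h5
      have := mul_le_mul_of_nonneg_left h6 (sq_nonneg M)
      linarith
    have h8 := le_of_mul_le_mul_right h7 (by positivity)
    exact (pow_le_pow_iff_left₀ (by positivity) hR0 two_ne_zero).mp h8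
  calc ‖S‖ + M * b ^ 2 / 4 * z ^ 2 ≤ M + M * b ^ 2 / 4 * z ^ 2 := by gcongr
    _ = M * (1 + (b * z) ^ 2 / 4) := by ring
    _ ≤ R := key
end

section
/- Example 3.6, local minimum with non-attained supremum. Let a : ℤ → ℂ be a bounded sequence with a_j ≠ 0 for all j ∈ ℤ. Set α = sup_{j ∈ ℤ} |a_j| and assume 0 < α and |a_j| < α for all j ∈ ℤ. Assume there is a sequence of indices jₙ ∈ ℤ (n ∈ ℕ) such that |a_{jₙ+1}| → α as n → ∞ and liminf_{n→∞} |a_{jₙ+2}| > 0. Let S : ℓ²(ℤ) →L[ℂ] ℓ²(ℤ) be the bounded operator satisfying (S x)_j = a_j · x_{j−1} for all x ∈ ℓ²(ℤ) and j ∈ ℤ. Then there exist C > 0 and ε₀ > 0 such that for every ζ ∈ ℂ with |ζ| ≤ ε₀, the operator I − ζ S is invertible and ‖S (I − ζ S)⁻¹‖ ≥ ‖S‖ + C·|ζ|². -/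
lemma aux_norm (i k : ℤ) (h : i ≠ k) (u v : ℂ) :
    ‖lp.single (E := fun _ : ℤ => ℂ) 2 i u + lp.single (E := fun _ : ℤ => ℂ) 2 k v‖ ^ 2
      = ‖u‖ ^ 2 + ‖v‖ ^ 2 := by
  have h0 : inner ℂ (lp.single (E := fun _ : ℤ => ℂ) 2 i u)
      (lp.single (E := fun _ : ℤ => ℂ) 2 k v) = 0 := by
    rw [lp.inner_single_left]
    simp [lp.single_apply, h]
  have := norm_add_sq_eq_norm_sq_add_norm_sq_of_inner_eq_zero _ _ h0
  rw [lp.norm_single (by norm_num), lp.norm_single (by norm_num)] at this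
  rw [pow_two, this]; ring

lemma aux_opNorm (a : ℤ → ℂ) (α : ℝ) (h0 : 0 ≤ α) (hle : ∀ j, ‖a j‖ ≤ α)
    (S : lp (fun _ : ℤ => ℂ) 2 →L[ℂ] lp (fun _ : ℤ => ℂ) 2)
    (hS : ∀ (x : lp (fun _ : ℤ => ℂ) 2) (j : ℤ), (S x) j = a j * x (j - 1)) : ‖S‖ ≤ α := by
  refine S.opNorm_le_bound h0 fun x => ?_
  have key : ∀ y : lp (fun _ : ℤ => ℂ) 2, HasSum (fun j => ‖y j‖ ^ 2) (‖y‖ ^ 2) := by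
    intro y
    have := lp.hasSum_norm (p := 2) (by norm_num) y
    simpa using this
  have h1 := key (S x)
  have h2 : HasSum (fun j : ℤ => α ^ 2 * ‖x (j - 1)‖ ^ 2) (α ^ 2 * ‖x‖ ^ 2) :=
    (((Equiv.subRight (1 : ℤ)).hasSum_iff).2 (key x)).mul_left _
  have h3 : ‖S x‖ ^ 2 ≤ α ^ 2 * ‖x‖ ^ 2 := by
    refine hasSum_le (fun j => ?_) h1 h2
    rw [hS, norm_mul, mul_pow]
    gcongr
    exact hle j
  rw [← mul_pow] at h3
  exact le_of_sq_le_sq h3 (by positivity)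

lemma aux_single (a : ℤ → ℂ)
    (S : lp (fun _ : ℤ => ℂ) 2 →L[ℂ] lp (fun _ : ℤ => ℂ) 2)
    (hS : ∀ (x : lp (fun _ : ℤ => ℂ) 2) (j : ℤ), (S x) j = a j * x (j - 1)) (i : ℤ) (u : ℂ) :
    S (lp.single (E := fun _ : ℤ => ℂ) 2 i u)
      = lp.single (E := fun _ : ℤ => ℂ) 2 (i + 1) (a (i + 1) * u) := by
  ext j
  rw [hS]
  by_cases h : j = i + 1
  · subst h; simp
  · have : j - 1 ≠ i := fun h' => h (by omega)
    simp [lp.single_apply, h, this]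

lemma aux_real_s14 (α δ w : ℝ) (hδ : 0 < δ) (hδα : δ ≤ α) (hw : 0 ≤ w)
    (h : w * (16 * α ^ 4) ≤ δ ^ 2) :
    (α + α * δ ^ 2 / 8 * w) ^ 2 * (1 + w ^ 2 * α ^ 4) ≤ α ^ 2 * (1 + w * δ ^ 2) := by
  have hα : 0 < α := hδ.trans_le hδα
  have e : (α + α * δ ^ 2 / 8 * w) ^ 2 = α ^ 2 * (1 + w * δ ^ 2 / 8) ^ 2 := by ring
  rw [e, mul_assoc]
  gcongr
  set s := w * δ ^ 2 with hs
  have hs0 : 0 ≤ s := by positivity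
  have h1 : w ^ 2 * α ^ 4 ≤ s / 16 := by
    have := mul_le_mul_of_nonneg_left h hw
    nlinarith
  have h2 : s ≤ 1 / 16 := by
    have a1 : δ ^ 2 ≤ α ^ 2 := by gcongr
    have a2 : w * (16 * α ^ 4) ≤ α ^ 2 := h.trans a1
    have a3 : w * α ^ 2 ≤ 1 / 16 := by
      have : α ^ 2 * (w * α ^ 2 * 16) ≤ α ^ 2 * 1 := by nlinarith
      have := le_of_mul_le_mul_left this (by positivity)
      linarith
    have : w * δ ^ 2 ≤ w * α ^ 2 := by gcongr
    linarith
  calc (1 + s / 8) ^ 2 * (1 + w ^ 2 * α ^ 4) ≤ (1 + s / 8) ^ 2 * (1 + s / 16) := by gcongr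
    _ ≤ (1 + s / 2) * (1 + s / 16) := by gcongr; nlinarith
    _ ≤ 1 + s := by nlinarith

/-- Example 3.6: local minimum of the resolvent norm at `0` for a weighted shift
whose weight supremum is not attained. -/
theorem weighted_shift_local_minimum_sup_not_attained
    (a : ℤ → ℂ) (ha : BddAbove (Set.range fun j => ‖a j‖))
    (hane : ∀ j : ℤ, a j ≠ 0)
    (hαpos : 0 < ⨆ j : ℤ, ‖a j‖)
    (hlt : ∀ j : ℤ, ‖a j‖ < ⨆ i : ℤ, ‖a i‖)
    (jn : ℕ → ℤ)
    (hjn : Filter.Tendsto (fun n => ‖a (jn n + 1)‖) Filter.atTop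
      (nhds (⨆ i : ℤ, ‖a i‖)))
    (hliminf : 0 < Filter.liminf (fun n => ‖a (jn n + 2)‖) Filter.atTop)
    (S : lp (fun _ : ℤ => ℂ) 2 →L[ℂ] lp (fun _ : ℤ => ℂ) 2)
    (hS : ∀ (x : lp (fun _ : ℤ => ℂ) 2) (j : ℤ), (S x) j = a j * x (j - 1)) :
    ∃ C > 0, ∃ ε₀ > 0, ∀ ζ : ℂ, ‖ζ‖ ≤ ε₀ →
      IsUnit (1 - ζ • S) ∧
      ‖S‖ + C * ‖ζ‖ ^ 2 ≤ ‖S * Ring.inverse (1 - ζ • S)‖ := by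
  set α := ⨆ j : ℤ, ‖a j‖ with hα
  obtain ⟨δ, hδ, hδl⟩ := exists_between hliminf
  have hev : ∀ᶠ n in Filter.atTop, δ < ‖a (jn n + 2)‖ :=
    Filter.eventually_lt_of_lt_liminf hδl
      (Filter.isBoundedUnder_of ⟨0, fun n => norm_nonneg _⟩)
  have hδα : δ ≤ α := by
    obtain ⟨n, hn⟩ := hev.exists
    exact (hn.trans (hlt _)).le
  have hSn : ‖S‖ ≤ α := aux_opNorm a α hαpos.le (fun j => (hlt j).le) S hS
  refine ⟨α * δ ^ 2 / 8, by positivity, δ / (4 * α ^ 2), by positivity, fun ζ hζ => ?_⟩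
  have hζ' : ‖ζ‖ * (4 * α ^ 2) ≤ δ := (le_div_iff₀ (by positivity)).1 hζ
  have hw : ‖ζ‖ ^ 2 * (16 * α ^ 4) ≤ δ ^ 2 := by
    calc ‖ζ‖ ^ 2 * (16 * α ^ 4) = (‖ζ‖ * (4 * α ^ 2)) ^ 2 := by ring
      _ ≤ δ ^ 2 := by gcongr
  have hsmall : ‖ζ • S‖ < 1 := by
    rw [norm_smul]
    have h1 : ‖ζ‖ * ‖S‖ ≤ ‖ζ‖ * α := by gcongr
    have h2 : α * (‖ζ‖ * α * 4) ≤ α * 1 := by nlinarith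
    have h3 := le_of_mul_le_mul_left h2 hαpos
    linarith
  have hu : IsUnit (1 - ζ • S) := isUnit_one_sub_of_norm_lt_one hsmall
  refine ⟨hu, ?_⟩
  set R := S * Ring.inverse (1 - ζ • S) with hR
  have hRm : R * (1 - ζ • S) = S := by
    rw [hR, mul_assoc, Ring.inverse_mul_cancel _ hu, mul_one]
  have main : ∀ᶠ n in Filter.atTop, ‖a (jn n + 1)‖ ^ 2 * (1 + ‖ζ‖ ^ 2 * δ ^ 2)
      ≤ ‖R‖ ^ 2 * (1 + (‖ζ‖ ^ 2) ^ 2 * α ^ 4) := by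
    filter_upwards [hev] with n hn
    set j := jn n
    set y := lp.single (E := fun _ : ℤ => ℂ) 2 j 1
      + lp.single (E := fun _ : ℤ => ℂ) 2 (j + 1) (ζ * a (j + 1)) with hy
    have hSy : S y = lp.single (E := fun _ : ℤ => ℂ) 2 (j + 1) (a (j + 1))
        + lp.single (E := fun _ : ℤ => ℂ) 2 (j + 2) (a (j + 2) * (ζ * a (j + 1))) := by
      rw [hy, map_add, aux_single a S hS, aux_single a S hS, mul_one, add_assoc j 1 1]
      rfl
    have hx : (1 - ζ • S) y = lp.single (E := fun _ : ℤ => ℂ) 2 j 1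
        + lp.single (E := fun _ : ℤ => ℂ) 2 (j + 2) (-(ζ * (a (j + 2) * (ζ * a (j + 1))))) := by
      have e : (1 - ζ • S) y = y - ζ • S y := rfl
      rw [e, hSy, hy, smul_add, ← lp.single_smul, ← lp.single_smul, smul_eq_mul, smul_eq_mul,
        lp.single_neg]
      abel
    have h1 : ‖S y‖ ≤ ‖R‖ * ‖(1 - ζ • S) y‖ := by
      have : S y = R ((1 - ζ • S) y) := by
        conv_lhs => rw [← hRm]
        rfl
      rw [this]
      exact R.le_opNorm _
    have h2 : ‖S y‖ ^ 2 ≤ ‖R‖ ^ 2 * ‖(1 - ζ • S) y‖ ^ 2 := by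
      rw [← mul_pow]; gcongr
    rw [hx, hSy, aux_norm _ _ (by omega), aux_norm _ _ (by omega)] at h2
    simp only [norm_neg, norm_mul, norm_one] at h2
    have b1 := (hlt (j + 1)).le
    have b2 := (hlt (j + 2)).le
    calc ‖a (j + 1)‖ ^ 2 * (1 + ‖ζ‖ ^ 2 * δ ^ 2)
        ≤ ‖a (j + 1)‖ ^ 2 * (1 + ‖ζ‖ ^ 2 * ‖a (j + 2)‖ ^ 2) := by gcongr
      _ = ‖a (j + 1)‖ ^ 2 + (‖a (j + 2)‖ * (‖ζ‖ * ‖a (j + 1)‖)) ^ 2 := by ring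
      _ ≤ _ := h2
      _ ≤ ‖R‖ ^ 2 * (1 ^ 2 + (‖ζ‖ * (α * (‖ζ‖ * α))) ^ 2) := by gcongr
      _ = _ := by ring
  have hlim : α ^ 2 * (1 + ‖ζ‖ ^ 2 * δ ^ 2) ≤ ‖R‖ ^ 2 * (1 + (‖ζ‖ ^ 2) ^ 2 * α ^ 4) :=
    le_of_tendsto ((hjn.pow 2).mul_const _) main
  have hr := (aux_real_s14 α δ (‖ζ‖ ^ 2) hδ hδα (by positivity) hw).trans hlim
  have hr2 := le_of_mul_le_mul_right hr (by positivity)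
  have hr3 := le_of_sq_le_sq hr2 (norm_nonneg _)
  linarith
end

section
/- Theorem 4.1 (polygonal paths in the pseudospectrum of a matrix). Let N ≥ 1, let E = EuclideanSpace ℂ (Fin N), and let A : E →L[ℂ] E be a linear operator. Let ε > 0 and define the ε-pseudospectrum σ_ε(A) = spectrum ℂ A ∪ { w ∈ ℂ : w ∉ spectrum ℂ A and ‖(A − w I)⁻¹‖ > 1/ε }. Then for every z ∈ σ_ε(A) there exist m ∈ ℕ and points x₀, x₁, …, x_m ∈ ℂ with x₀ = z, x_m ∈ spectrum ℂ A, and for each i < m the segment [x_i, x_{i+1}] = { x_i + t(x_{i+1} − x_i) : t ∈ [0,1] } is contained in σ_ε(A). -/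
open Topology in
theorem pseudo_aux {B : Type*} [NormedRing B] [NormedAlgebra ℂ B] [CompleteSpace B]
    [NormOneClass B] (A : B) (ε : ℝ) (hε : 0 < ε) (S : Set ℂ)
    (hS : S = spectrum ℂ A ∪ {w : ℂ | w ∉ spectrum ℂ A ∧
        ‖Ring.inverse (A - algebraMap ℂ B w)‖ > ε⁻¹}) (z : ℂ) (hz : z ∈ S) :
    ∃ w ∈ spectrum ℂ A, Relation.ReflTransGen (fun a b => segment ℝ a b ⊆ S) z w := by
  have hnt : Nontrivial B := NormOneClass.nontrivial
  have hunit : ∀ w, w ∉ spectrum ℂ A ↔ IsUnit (A - algebraMap ℂ B w) := by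
    intro w
    rw [spectrum.notMem_iff, ← IsUnit.neg_iff, neg_sub]
  have hdiff : ∀ w, w ∉ spectrum ℂ A →
      DifferentiableAt ℂ (fun w => Ring.inverse (A - algebraMap ℂ B w)) w := by
    intro w hw
    obtain ⟨u, hu⟩ := (hunit w).1 hw
    have h1 : DifferentiableAt ℂ (fun w : ℂ => A - algebraMap ℂ B w) w := by
      have : DifferentiableAt ℂ (fun w : ℂ => A - w • (1 : B)) w := by fun_prop
      simpa only [Algebra.algebraMap_eq_smul_one] using this
    have h2 : DifferentiableAt ℂ (Ring.inverse : B → B) (A - algebraMap ℂ B w) := by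
      rw [← hu]; exact differentiableAt_inverse u.isUnit
    exact h2.comp w h1
  have hpert : ∀ v w, v ∉ spectrum ℂ A → ‖Ring.inverse (A - algebraMap ℂ B v)‖ ≤ ε⁻¹ →
      dist v w < ε → w ∉ spectrum ℂ A := by
    intro v w hv hle hd
    obtain ⟨u, hu⟩ := (hunit v).1 hv
    rw [← hu, Ring.inverse_unit] at hle
    have hpos : 0 < ‖(↑u⁻¹ : B)‖ := Units.norm_pos u⁻¹
    have h3 : ε ≤ ‖(↑u⁻¹ : B)‖⁻¹ := (le_inv_comm₀ hpos hε).1 hle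
    rw [hunit]
    have h4 : ‖algebraMap ℂ B (v - w)‖ < ‖(↑u⁻¹ : B)‖⁻¹ := by
      rw [norm_algebraMap', ← dist_eq_norm]; linarith
    refine ⟨u.add _ h4, ?_⟩
    rw [Units.val_add, hu, map_sub]; abel
  have hopen : IsOpen S := by
    rw [Metric.isOpen_iff]
    intro p hp
    by_cases hps : p ∈ spectrum ℂ A
    · refine ⟨ε, hε, fun v hv => ?_⟩
      rw [hS]
      by_contra hc
      simp only [Set.mem_union, Set.mem_ofPred_eq, not_or, not_and, not_lt, gt_iff_lt] at hc
      exact hpert v p hc.1 (hc.2 hc.1) hv hps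
    · rw [← Metric.mem_nhds_iff]
      rw [hS] at hp
      have hp2 := (hp.resolve_left hps).2
      have hc := (hdiff p hps).continuousAt.norm
      have ho : ∀ᶠ v in 𝓝 p, v ∉ spectrum ℂ A :=
        (spectrum.isClosed A).isOpen_compl.mem_nhds hps
      filter_upwards [hc.eventually (lt_mem_nhds hp2), ho] with v h1 h2
      rw [hS]
      exact Or.inr ⟨h2, h1⟩
  have hbdd : Bornology.IsBounded S := by
    refine (Metric.isBounded_closedBall (x := (0 : ℂ)) (r := ‖A‖ + ε)).subset ?_
    intro w hw
    rw [mem_closedBall_zero_iff]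
    rw [hS] at hw
    rcases hw with hw | ⟨hw, hgt⟩
    · have := spectrum.norm_le_norm_of_mem hw
      linarith
    · set R := Ring.inverse (A - algebraMap ℂ B w) with hR
      have h1 : R * (A - algebraMap ℂ B w) = 1 := Ring.inverse_mul_cancel _ ((hunit w).1 hw)
      have h2 : w • R = R * A - 1 := by
        rw [← h1, mul_sub, ← Algebra.commutes, ← Algebra.smul_def]; abel
      have h3 : ‖w‖ * ‖R‖ ≤ ‖R‖ * ‖A‖ + 1 := by
        rw [← norm_smul, h2]
        refine (norm_sub_le _ _).trans ?_
        rw [norm_one]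
        gcongr
        exact norm_mul_le _ _
      have hpos : 0 < ‖R‖ := lt_trans (inv_pos.2 hε) hgt
      have h5 : 1 < ‖R‖ * ε := by
        have := mul_lt_mul_of_pos_right hgt hε
        rwa [inv_mul_cancel₀ hε.ne'] at this
      by_contra hc
      push Not at hc
      nlinarith [mul_lt_mul_of_pos_right hc hpos]
  by_contra hno
  push Not at hno
  set U : Set ℂ := {w | Relation.ReflTransGen (fun a b => segment ℝ a b ⊆ S) z w} with hU
  have hUS : U ⊆ S := by
    intro w hw
    rcases Relation.ReflTransGen.cases_tail hw with h | ⟨c, _, hc⟩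
    · rw [h]; exact hz
    · exact hc (right_mem_segment ℝ c w)
  have hUspec : ∀ w ∈ U, w ∉ spectrum ℂ A := fun w hw hs => hno w hs hw
  have hUopen : IsOpen U := by
    rw [Metric.isOpen_iff]
    intro p hp
    obtain ⟨r, hr, hball⟩ := Metric.isOpen_iff.1 hopen p (hUS hp)
    refine ⟨r, hr, fun q hq => ?_⟩
    exact Relation.ReflTransGen.tail hp
      (((convex_ball p r).segment_subset (Metric.mem_ball_self hr) hq).trans hball)
  have hfr : ∀ p ∈ frontier U, p ∉ S := by
    intro p hp hpS
    rw [hUopen.frontier_eq] at hp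
    obtain ⟨r, hr, hball⟩ := Metric.isOpen_iff.1 hopen p hpS
    obtain ⟨q, hqU, hq⟩ := Metric.mem_closure_iff.1 hp.1 r hr
    rw [dist_comm] at hq
    exact hp.2 (Relation.ReflTransGen.tail hqU
      (((convex_ball p r).segment_subset hq (Metric.mem_ball_self hr)).trans hball))
  have hcl : ∀ p ∈ closure U, p ∉ spectrum ℂ A := by
    intro p hp hs
    by_cases hpU : p ∈ U
    · exact hUspec p hpU hs
    · refine hfr p ?_ (by rw [hS]; exact Or.inl hs)
      rw [hUopen.frontier_eq]; exact ⟨hp, hpU⟩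
  have hzU : z ∈ U := Relation.ReflTransGen.refl
  have hd : DiffContOnCl ℂ (fun w => Ring.inverse (A - algebraMap ℂ B w)) U :=
    DifferentiableOn.diffContOnCl fun p hp => (hdiff p (hcl p hp)).differentiableWithinAt
  have hmax := Complex.norm_le_of_forall_mem_frontier_norm_le (hbdd.subset hUS) hd
    (C := ε⁻¹) (fun p hp => by
      by_contra hc
      refine hfr p hp ?_
      rw [hS]
      exact Or.inr ⟨hcl p (frontier_subset_closure hp), not_le.1 hc⟩) (subset_closure hzU)
  rw [hS] at hz
  exact absurd (hz.resolve_left (hUspec z hzU)).2 (not_lt.2 hmax)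

theorem path_aux (r : ℂ → ℂ → Prop) (z w : ℂ) (h : Relation.ReflTransGen r z w) :
    ∃ m : ℕ, ∃ x : ℕ → ℂ, x 0 = z ∧ x m = w ∧ ∀ i < m, r (x i) (x (i + 1)) := by
  induction h using Relation.ReflTransGen.head_induction_on with
  | refl => exact ⟨0, fun _ => w, rfl, rfl, by simp⟩
  | @head a c hac _ ih =>
    obtain ⟨m, x, h0, hm, hx⟩ := ih
    refine ⟨m + 1, fun n => Nat.casesOn n a x, rfl, hm, ?_⟩
    rintro (_ | i) hi
    · simpa [h0] using hac
    · exact hx i (by omega)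

/-- Theorem 4.1: every point of the ε-pseudospectrum of a matrix can be linked
to an eigenvalue through a finite polygonal path inside the pseudospectrum. -/
theorem pseudospectrum_polygonal_path
    (N : ℕ) (hN : 1 ≤ N)
    (A : EuclideanSpace ℂ (Fin N) →L[ℂ] EuclideanSpace ℂ (Fin N))
    (ε : ℝ) (hε : 0 < ε)
    (z : ℂ)
    (hz : z ∈ spectrum ℂ A ∪
      {w : ℂ | w ∉ spectrum ℂ A ∧
        ‖Ring.inverse (A - algebraMap ℂ
          (EuclideanSpace ℂ (Fin N) →L[ℂ] EuclideanSpace ℂ (Fin N)) w)‖ > ε⁻¹}) :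
    ∃ m : ℕ, ∃ x : ℕ → ℂ, x 0 = z ∧ x m ∈ spectrum ℂ A ∧
      ∀ i < m, segment ℝ (x i) (x (i + 1)) ⊆
        spectrum ℂ A ∪
          {w : ℂ | w ∉ spectrum ℂ A ∧
            ‖Ring.inverse (A - algebraMap ℂ
              (EuclideanSpace ℂ (Fin N) →L[ℂ] EuclideanSpace ℂ (Fin N)) w)‖ > ε⁻¹} := by
  have : NeZero N := ⟨by omega⟩
  have : Nontrivial (EuclideanSpace ℂ (Fin N)) := inferInstance
  obtain ⟨w, hw, h⟩ := pseudo_aux A ε hε _ rfl z hz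
  obtain ⟨m, x, h0, hm, hx⟩ := path_aux _ z w h
  exact ⟨m, x, h0, hm ▸ hw, hx⟩
end
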